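/- arXiv:1409.7940 — 3 statements merged into one kernel-verified Lean document; each statement's English description precedes it below -/
import Mathlib

section
/- Shape of q: For every y ∈ I, the function x ↦ q(y,x) is nonnegative, finite and continuous on I, satisfies q(y,y) = 0, is strictly convex on I, is strictly decreasing on (l,y], is strictly increasing on [y,r), and equals +∞ for every x ∈ ℝ∖[l,r]. -/
open MeasureTheory Filter Set Topology
open scoped ENNReal

/-- The integrand `2/η(z)²`, valued in `[0,∞]` (it equals `∞` where `η` vanishes). -/
noncomputable def qIntegrand (η : ℝ → ℝ) (z : ℝ) : ℝ≥0∞ :=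
  2 / ENNReal.ofReal ((η z) ^ 2)

/-- `q(y,x) = ∫_y^x ∫_y^u 2/η(z)² dz du ∈ [0,∞]`, the oriented iterated integral (nonnegative
also for `x < y`, since both orientations flip). -/
noncomputable def qfun (η : ℝ → ℝ) (y x : ℝ) : ℝ≥0∞ :=
  if y ≤ x then ∫⁻ u in Set.Ioc y x, ∫⁻ z in Set.Ioc y u, qIntegrand η z
  else ∫⁻ u in Set.Ioc x y, ∫⁻ z in Set.Ioc u y, qIntegrand η z

/-- `G_y(a) = ∫_ℝ q(y, y + a x) μ(dx) ∈ [0,∞]`. -/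
noncomputable def Gfun (η : ℝ → ℝ) (μ : Measure ℝ) (y a : ℝ) : ℝ≥0∞ :=
  ∫⁻ x, qfun η y (y + a * x) ∂μ

theorem setLIntegral_Ioc_eq_ofReal_intervalIntegral {a b : ℝ} (hab : a ≤ b) {g : ℝ → ℝ}
    {h : ℝ → ℝ≥0∞} (hg : IntervalIntegrable g volume a b) (hg0 : ∀ z ∈ Ioc a b, 0 ≤ g z)
    (hgh : ∀ z ∈ Ioc a b, h z = ENNReal.ofReal (g z)) :
    ∫⁻ z in Ioc a b, h z = ENNReal.ofReal (∫ z in a..b, g z) := by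
  rw [intervalIntegral.integral_of_le hab, ofReal_integral_eq_lintegral_ofReal
    ((intervalIntegrable_iff_integrableOn_Ioc_of_le hab).1 hg)
    ((ae_restrict_iff' measurableSet_Ioc).2 (.of_forall hg0))]
  exact setLIntegral_congr_fun measurableSet_Ioc hgh

theorem qIntegrand_eq_ofReal {η : ℝ → ℝ} {z : ℝ} (hz : η z ≠ 0) :
    qIntegrand η z = ENNReal.ofReal (2 / η z ^ 2) := by
  rw [qIntegrand, ENNReal.ofReal_div_of_pos (by positivity)]
  simp

theorem qIntegrand_eq_top {η : ℝ → ℝ} {z : ℝ} (hz : η z = 0) : qIntegrand η z = ⊤ := by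
  simp [qIntegrand, hz, ENNReal.div_zero]

theorem MeasureTheory.LocallyIntegrableOn.intervalIntegrable_of_mem {I : Set ℝ}
    (hI : I.OrdConnected) {f : ℝ → ℝ} (hf : LocallyIntegrableOn f I volume) {a b : ℝ}
    (ha : a ∈ I) (hb : b ∈ I) : IntervalIntegrable f volume a b :=
  (hf.integrableOn_compact_subset (hI.uIcc_subset ha hb) isCompact_uIcc).intervalIntegrable

theorem MeasureTheory.LocallyIntegrableOn.continuousOn_intervalIntegral {I : Set ℝ}
    (hIopen : IsOpen I) (hI : I.OrdConnected) {f : ℝ → ℝ} (hf : LocallyIntegrableOn f I volume)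
    {y : ℝ} (hy : y ∈ I) : ContinuousOn (fun u => ∫ z in y..u, f z) I := by
  intro x hx
  obtain ⟨ε, hε, hball⟩ := Metric.nhds_basis_closedBall.mem_iff.1 (hIopen.mem_nhds hx)
  rw [Real.closedBall_eq_Icc] at hball
  have ha : min (x - ε) y ∈ I := by
    rcases min_choice (x - ε) y with h | h <;> rw [h]
    exacts [hball ⟨le_rfl, by linarith⟩, hy]
  have hb : max (x + ε) y ∈ I := by
    rcases max_choice (x + ε) y with h | h <;> rw [h]
    exacts [hball ⟨by linarith, le_rfl⟩, hy]
  have hle : min (x - ε) y ≤ max (x + ε) y := (min_le_right _ _).trans (le_max_right _ _)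
  have hcont := intervalIntegral.continuousOn_primitive_interval'
    (hf.intervalIntegrable_of_mem hI ha hb) (a := y)
    (by rw [uIcc_of_le hle]; exact ⟨min_le_right _ _, le_max_right _ _⟩)
  rw [uIcc_of_le hle] at hcont
  exact (hcont.continuousAt (Icc_mem_nhds ((min_le_left _ _).trans_lt (by linarith))
    (lt_of_lt_of_le (by linarith) (le_max_left _ _)))).continuousWithinAt

theorem qfun_eq_ofReal {I : Set ℝ} (hIopen : IsOpen I) (hI : I.OrdConnected) {η : ℝ → ℝ}
    (hηne : ∀ x ∈ I, η x ≠ 0) (hf : LocallyIntegrableOn (fun z => 2 / η z ^ 2) I volume)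
    {y x : ℝ} (hy : y ∈ I) (hx : x ∈ I) :
    qfun η y x = ENNReal.ofReal (∫ u in y..x, ∫ z in y..u, 2 / η z ^ 2) := by
  have hF := hf.continuousOn_intervalIntegral hIopen hI hy
  have hinner : ∀ a ∈ I, ∀ b ∈ I, a ≤ b →
      ∫⁻ z in Ioc a b, qIntegrand η z = ENNReal.ofReal (∫ z in a..b, 2 / η z ^ 2) :=
    fun a ha b hb hab => setLIntegral_Ioc_eq_ofReal_intervalIntegral hab
      (hf.intervalIntegrable_of_mem hI ha hb) (fun z _ => by positivity)
      fun z hz => qIntegrand_eq_ofReal (hηne z (hI.out ha hb (Ioc_subset_Icc_self hz)))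
  have hFint : IntervalIntegrable (fun u => ∫ z in y..u, 2 / η z ^ 2) volume y x :=
    (hF.mono (hI.uIcc_subset hy hx)).intervalIntegrable
  rw [qfun]
  split_ifs with hyx
  · exact setLIntegral_Ioc_eq_ofReal_intervalIntegral hyx hFint
      (fun u hu => intervalIntegral.integral_nonneg hu.1.le fun z _ => by positivity)
      fun u hu => hinner y hy u (hI.out hy hx (Ioc_subset_Icc_self hu)) hu.1.le
  · have hxy := (not_le.1 hyx).le
    rw [intervalIntegral.integral_symm, ← intervalIntegral.integral_neg]
    refine setLIntegral_Ioc_eq_ofReal_intervalIntegral hxy hFint.symm.neg (fun u hu => ?_)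
      fun u hu => ?_
    · rw [← intervalIntegral.integral_symm]
      exact intervalIntegral.integral_nonneg hu.2 fun z _ => by positivity
    · rw [← intervalIntegral.integral_symm]
      exact hinner u (hI.out hx hy (Ioc_subset_Icc_self hu)) y hy hu.2

theorem qfun_eq_top_of_notMem_closure {I : Set ℝ} {η : ℝ → ℝ} (hηzero : ∀ x ∉ I, η x = 0)
    {y x : ℝ} (hy : y ∈ I) (hx : x ∉ closure I) : qfun η y x = ⊤ := by
  obtain ⟨ε, hε, hball⟩ := Metric.isOpen_iff.1 isClosed_closure.isOpen_compl x hx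
  have hout : ∀ z ∈ Ioo (x - ε) (x + ε), z ∉ I := fun z hz hzI =>
    hball (by rwa [Real.ball_eq_Ioo]) (subset_closure hzI)
  have htop : ∀ (g : ℝ → ℝ≥0∞) (a b : ℝ) (s : Set ℝ), a < b → Ioo a b ⊆ s →
      (∀ z ∈ Ioo a b, g z = ⊤) → ∫⁻ z in s, g z = ⊤ := by
    intro g a b s hab hs hg
    refine top_unique (le_trans ?_ (lintegral_mono_set hs))
    rw [setLIntegral_congr_fun measurableSet_Ioo hg]
    simp [ENNReal.top_mul, hab]
  have hq : ∀ z ∈ Ioo (x - ε) (x + ε), qIntegrand η z = ⊤ := fun z hz =>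
    qIntegrand_eq_top (hηzero z (hout z hz))
  rw [qfun]
  split_ifs with hyx
  · have hyε : y ≤ x - ε := by
      by_contra! h
      exact hout y ⟨h, by linarith⟩ hy
    refine htop _ (x - ε / 2) x _ (by linarith)
      (fun z hz => ⟨by linarith [hz.1], hz.2.le⟩) fun u hu => ?_
    exact htop _ (x - ε) (x - ε / 2) _ (by linarith)
      (fun z hz => ⟨by linarith [hz.1], by linarith [hz.2, hu.1]⟩)
      fun z hz => hq z ⟨hz.1, by linarith [hz.2]⟩
  · have hyε : x + ε ≤ y := by
      by_contra! h
      exact hout y ⟨by linarith, h⟩ hy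
    refine htop _ x (x + ε / 2) _ (by linarith)
      (fun z hz => ⟨hz.1, by linarith [hz.2]⟩) fun u hu => ?_
    exact htop _ (x + ε / 2) (x + ε) _ (by linarith)
      (fun z hz => ⟨by linarith [hz.1, hu.2], by linarith [hz.2]⟩)
      fun z hz => hq z ⟨by linarith [hz.1], hz.2⟩

/-- **Shape of `q`**: for every `y ∈ I`, the function `x ↦ q(y,x)` is nonnegative, finite and
continuous on `I`, satisfies `q(y,y) = 0`, is strictly convex on `I`, strictly decreasing on
`(l,y]`, strictly increasing on `[y,r)`, and equals `+∞` outside `[l,r] = closure I`.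
Here `I` is an open subinterval of `ℝ` (an open order-connected set). -/
theorem qfun_shape
    (I : Set ℝ) (hIopen : IsOpen I) (hIconn : I.OrdConnected)
    (η : ℝ → ℝ) (hηmeas : Measurable η)
    (hηne : ∀ x ∈ I, η x ≠ 0) (hηzero : ∀ x ∉ I, η x = 0)
    (hηloc : LocallyIntegrableOn (fun z => 1 / (η z) ^ 2) I volume) :
    ∀ y ∈ I,
      (∀ x : ℝ, 0 ≤ (qfun η y x).toReal) ∧
      qfun η y y = 0 ∧
      (∀ x ∈ I, qfun η y x < ⊤) ∧
      ContinuousOn (fun x => (qfun η y x).toReal) I ∧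
      StrictConvexOn ℝ I (fun x => (qfun η y x).toReal) ∧
      StrictAntiOn (fun x => (qfun η y x).toReal) (I ∩ Set.Iic y) ∧
      StrictMonoOn (fun x => (qfun η y x).toReal) (I ∩ Set.Ici y) ∧
      (∀ x : ℝ, x ∉ closure I → qfun η y x = ⊤) := by
  intro y hy
  have hf : LocallyIntegrableOn (fun z => 2 / η z ^ 2) I volume := by
    have h2 := hηloc.smul (2 : ℝ)
    convert h2 using 2 with z
    simp [div_eq_mul_inv]
  have hF := hf.continuousOn_intervalIntegral hIopen hIconn hy
  have hFlt : ∀ a ∈ I, ∀ b ∈ I, a < b → 0 < ∫ z in a..b, 2 / η z ^ 2 := by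
    intro a ha b hb hab
    refine intervalIntegral.intervalIntegral_pos_of_pos_on
      (hf.intervalIntegrable_of_mem hIconn ha hb) (fun z hz => ?_) hab
    have := hηne z (hIconn.out ha hb (Ioo_subset_Icc_self hz))
    positivity
  have hFmono : StrictMonoOn (fun u => ∫ z in y..u, 2 / η z ^ 2) I := by
    intro a ha b hb hab
    have hadd := intervalIntegral.integral_add_adjacent_intervals
      (hf.intervalIntegrable_of_mem hIconn hy ha) (hf.intervalIntegrable_of_mem hIconn ha hb)
    have := hFlt a ha b hb hab
    simp only
    linarith
  have hconv : Convex ℝ I := hIconn.convex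
  have hQnonneg : ∀ x ∈ I, 0 ≤ ∫ u in y..x, ∫ z in y..u, 2 / η z ^ 2 := by
    intro x hx
    rcases le_total y x with h | h
    · exact intervalIntegral.integral_nonneg h fun u hu =>
        intervalIntegral.integral_nonneg hu.1 fun z _ => by positivity
    · rw [intervalIntegral.integral_symm, ← intervalIntegral.integral_neg]
      refine intervalIntegral.integral_nonneg h fun u hu => ?_
      rw [← intervalIntegral.integral_symm]
      exact intervalIntegral.integral_nonneg hu.2 fun z _ => by positivity
  have hQ : ∀ x ∈ I, (qfun η y x).toReal = ∫ u in y..x, ∫ z in y..u, 2 / η z ^ 2 :=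
    fun x hx => by
      rw [qfun_eq_ofReal hIopen hIconn hηne hf hy hx, ENNReal.toReal_ofReal (hQnonneg x hx)]
  have hderiv : ∀ x ∈ I,
      HasDerivAt (fun x => (qfun η y x).toReal) (∫ z in y..x, 2 / η z ^ 2) x := fun x hx =>
    (intervalIntegral.integral_hasDerivAt_right
      (hF.mono (hIconn.uIcc_subset hy hx)).intervalIntegrable
      (hF.stronglyMeasurableAtFilter hIopen x hx)
      (hF.continuousAt (hIopen.mem_nhds hx))).congr_of_eventuallyEq
      (eventually_of_mem (hIopen.mem_nhds hx) hQ)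
  have hcont : ContinuousOn (fun x => (qfun η y x).toReal) I := fun x hx =>
    (hderiv x hx).continuousAt.continuousWithinAt
  refine ⟨fun _ => ENNReal.toReal_nonneg, by simp [qfun], fun x hx => ?_, hcont, ?_, ?_, ?_,
    fun x hx => qfun_eq_top_of_notMem_closure hηzero hy hx⟩
  · rw [qfun_eq_ofReal hIopen hIconn hηne hf hy hx]
    exact ENNReal.ofReal_lt_top
  · refine StrictMonoOn.strictConvexOn_of_deriv hconv hcont ?_
    rw [hIopen.interior_eq]
    exact hFmono.congr fun x hx => (hderiv x hx).deriv.symm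
  · refine strictAntiOn_of_deriv_neg (hconv.inter (convex_Iic y)) (hcont.mono inter_subset_left) ?_
    rw [interior_inter, hIopen.interior_eq, interior_Iic]
    intro x hx
    rw [(hderiv x hx.1).deriv, intervalIntegral.integral_symm]
    exact neg_neg_of_pos (hFlt x hx.1 y hy hx.2)
  · refine strictMonoOn_of_deriv_pos (hconv.inter (convex_Ici y)) (hcont.mono inter_subset_left) ?_
    rw [interior_inter, hIopen.interior_eq, interior_Ici]
    intro x hx
    rw [(hderiv x hx.1).deriv]
    exact hFlt y hy x hx.1 hx.2
end

section
/- Regularity of G_y: For every y ∈ I the function G_y: [0,∞) → [0,∞] satisfies: G_y(0) = 0; G_y is strictly increasing in the sense that for all 0 ≤ a < b either G_y(a) < G_y(b) or G_y(a) = G_y(b) = ∞; G_y is left-continuous on (0,∞); and G_y is continuous at every point of [0,∞)∖{a_inf}, where a_inf := inf{a ∈ [0,∞) : G_y(a) = ∞} (with inf ∅ := ∞). -/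
open MeasureTheory Filter Set Topology
open scoped ENNReal

lemma measurable_qIntegrand {η : ℝ → ℝ} (hη : Measurable η) : Measurable (qIntegrand η) :=
  measurable_const.div (hη.pow_const 2).ennreal_ofReal

lemma qIntegrand_ne_zero (η : ℝ → ℝ) (z : ℝ) : qIntegrand η z ≠ 0 :=
  ENNReal.div_ne_zero.mpr ⟨two_ne_zero, ENNReal.ofReal_ne_top⟩

/-- The measure with density `u ↦ ∫_y^u 2/η(z)² dz` with respect to Lebesgue measure. -/
noncomputable def qMeasure (η : ℝ → ℝ) (y : ℝ) : Measure ℝ :=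
  volume.withDensity fun u => volume.withDensity (qIntegrand η) (uIoc y u)

instance (η : ℝ → ℝ) (y : ℝ) : SFinite (qMeasure η y) := by
  unfold qMeasure; infer_instance

instance (η : ℝ → ℝ) (y : ℝ) : NullSingletonClass (qMeasure η y) := by
  unfold qMeasure; infer_instance

lemma measurable_measure_uIoc (ν : Measure ℝ) [SFinite ν] (y : ℝ) :
    Measurable fun u => ν (uIoc y u) := by
  have hs : MeasurableSet {p : ℝ × ℝ | p.2 ∈ uIoc y p.1} := by
    simp only [uIoc, mem_Ioc]
    exact (measurableSet_lt (measurable_const.min measurable_fst) measurable_snd).inter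
      (measurableSet_le measurable_snd (measurable_const.max measurable_fst))
  exact measurable_measure_prodMk_left hs

lemma qfun_eq_qMeasure (η : ℝ → ℝ) (y x : ℝ) :
    qfun η y x = qMeasure η y (uIoc y x) := by
  rw [qMeasure, withDensity_apply _ measurableSet_uIoc, qfun]
  split_ifs with h
  · rw [uIoc_of_le h]
    refine setLIntegral_congr_fun measurableSet_Ioc fun u hu => ?_
    rw [withDensity_apply _ measurableSet_uIoc, uIoc_of_le hu.1.le]
  · rw [uIoc_of_ge (not_le.mp h).le]
    refine setLIntegral_congr_fun measurableSet_Ioc fun u hu => ?_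
    rw [withDensity_apply _ measurableSet_uIoc, uIoc_of_ge hu.2]

lemma qMeasure_ne_zero_of_uIoo_subset {η : ℝ → ℝ} (hη : Measurable η) {y c d : ℝ} {s : Set ℝ}
    (hcd : c ≠ d) (hs : uIoo c d ⊆ s) : qMeasure η y s ≠ 0 := by
  have hpos : ∀ u, u ≠ y → volume.withDensity (qIntegrand η) (uIoc y u) ≠ 0 := by
    intro u hu h0
    rw [withDensity_apply_eq_zero (measurable_qIntegrand hη)] at h0
    simp only [ne_eq, qIntegrand_ne_zero, not_false_eq_true, ofPred_true, univ_inter, uIoc,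
      Real.volume_Ioc, ENNReal.ofReal_eq_zero, sub_nonpos, max_le_iff, le_min_iff] at h0
    exact hu (le_antisymm h0.1.2 h0.2.1)
  intro h0
  rw [qMeasure, withDensity_apply_eq_zero (measurable_measure_uIoc _ y)] at h0
  have h1 : volume (uIoo c d) = 0 := by
    refine measure_mono_null (t := _ ∪ {y}) (fun u hu => ?_)
      (measure_union_null h0 (measure_singleton y))
    by_cases huy : u = y
    · exact Or.inr huy
    · exact Or.inl ⟨hpos u huy, hs hu⟩
  simp only [uIoo, Real.volume_Ioo, ENNReal.ofReal_eq_zero, sub_nonpos] at h1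
  rw [max_le_iff, le_min_iff, le_min_iff] at h1
  exact hcd (le_antisymm h1.1.2 h1.2.1)

section NullSingleton

variable (ν : Measure ℝ) [NullSingletonClass ν] (y z : ℝ)

lemma measure_uIoc_eq_uIoo : ν (uIoc y z) = ν (uIoo y z) :=
  measure_congr Ioo_ae_eq_Ioc.symm

lemma measure_uIoc_eq_uIcc : ν (uIoc y z) = ν (uIcc y z) :=
  measure_congr Ioc_ae_eq_Icc

end NullSingleton

lemma uIoc_add_mul_subset {a b : ℝ} (ha : 0 ≤ a) (hab : a ≤ b) (y x : ℝ) :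
    uIoc y (y + a * x) ⊆ uIoc y (y + b * x) := by
  rcases le_total 0 x with hx | hx
  · rw [uIoc_of_le (by nlinarith), uIoc_of_le (by nlinarith)]
    exact Ioc_subset_Ioc_right (by nlinarith)
  · rw [uIoc_of_ge (by nlinarith), uIoc_of_ge (by nlinarith)]
    exact Ioc_subset_Ioc_left (by nlinarith)

lemma uIoo_add_mul_subset_diff {a b x : ℝ} (ha : 0 ≤ a) (hab : a < b) (y : ℝ) :
    uIoo (y + a * x) (y + b * x) ⊆ uIoc y (y + b * x) \ uIoc y (y + a * x) := by
  intro u hu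
  rcases le_total 0 x with hx | hx
  · rw [uIoo_of_le (by nlinarith)] at hu
    rw [uIoc_of_le (by nlinarith), uIoc_of_le (by nlinarith)]
    exact ⟨⟨by nlinarith [hu.1], hu.2.le⟩, fun h => h.2.not_gt hu.1⟩
  · rw [uIoo_of_ge (by nlinarith)] at hu
    rw [uIoc_of_ge (by nlinarith), uIoc_of_ge (by nlinarith)]
    exact ⟨⟨hu.1, by nlinarith [hu.2]⟩, fun h => h.1.not_gt hu.2⟩

lemma measure_uIoc_add_mul_eq_iSup (ν : Measure ℝ) [NullSingletonClass ν] {a : ℝ} {b : ℕ → ℝ}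
    (hmono : Monotone b) (hpos : ∀ n, 0 ≤ b n) (hlt : ∀ n, b n < a)
    (hb : Tendsto b atTop (𝓝 a)) (y x : ℝ) :
    ν (uIoc y (y + a * x)) = ⨆ n, ν (uIoc y (y + b n * x)) := by
  have hm : Monotone fun n => uIoc y (y + b n * x) := fun m n h =>
    uIoc_add_mul_subset (hpos m) (hmono h) y x
  rw [← hm.measure_iUnion]
  refine le_antisymm ?_ (measure_mono (iUnion_subset fun n =>
    uIoc_add_mul_subset (hpos n) (hlt n).le y x))
  rw [measure_uIoc_eq_uIoo]
  refine measure_mono fun u hu => mem_iUnion.mpr ?_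
  have ht : Tendsto (fun n => y + b n * x) atTop (𝓝 (y + a * x)) :=
    (hb.mul_const x).const_add y
  have ha : 0 ≤ a := (hpos 0).trans (hlt 0).le
  rcases le_total 0 x with hx | hx
  · rw [uIoo_of_le (by nlinarith)] at hu
    obtain ⟨n, hn⟩ := (ht.eventually (lt_mem_nhds hu.2)).exists
    refine ⟨n, ?_⟩
    rw [uIoc_of_le (by nlinarith [hpos n])]
    exact ⟨hu.1, hn.le⟩
  · rw [uIoo_of_ge (by nlinarith)] at hu
    obtain ⟨n, hn⟩ := (ht.eventually (gt_mem_nhds hu.1)).exists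
    refine ⟨n, ?_⟩
    rw [uIoc_of_ge (by nlinarith [hpos n])]
    exact ⟨hn, hu.2.le⟩

lemma measure_uIoc_add_mul_eq_iInf (ν : Measure ℝ) [NullSingletonClass ν] {a : ℝ} {b : ℕ → ℝ}
    (hanti : Antitone b) (ha : 0 ≤ a) (hlt : ∀ n, a < b n)
    (hb : Tendsto b atTop (𝓝 a)) {y x : ℝ} (hfin : ν (uIoc y (y + b 0 * x)) ≠ ⊤) :
    ν (uIoc y (y + a * x)) = ⨅ n, ν (uIoc y (y + b n * x)) := by
  have hm : Antitone fun n => uIoc y (y + b n * x) := fun m n h =>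
    uIoc_add_mul_subset (ha.trans (hlt n).le) (hanti h) y x
  rw [← hm.measure_iInter (fun n => measurableSet_uIoc.nullMeasurableSet) ⟨0, hfin⟩]
  refine le_antisymm (measure_mono (subset_iInter fun n =>
    uIoc_add_mul_subset ha (hlt n).le y x)) ?_
  rw [measure_uIoc_eq_uIcc ν y (y + a * x)]
  refine measure_mono fun u hu => ?_
  rw [mem_iInter] at hu
  have ht : Tendsto (fun n => y + b n * x) atTop (𝓝 (y + a * x)) :=
    (hb.mul_const x).const_add y
  rcases le_total 0 x with hx | hx
  · have hu' : ∀ n, u ∈ Ioc y (y + b n * x) := fun n => by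
      have := hu n
      rwa [uIoc_of_le (by nlinarith [hlt n])] at this
    rw [uIcc_of_le (by nlinarith)]
    exact ⟨(hu' 0).1.le, ge_of_tendsto' ht fun n => (hu' n).2⟩
  · have hu' : ∀ n, u ∈ Ioc (y + b n * x) y := fun n => by
      have := hu n
      rwa [uIoc_of_ge (by nlinarith [hlt n])] at this
    rw [uIcc_of_ge (by nlinarith)]
    exact ⟨le_of_tendsto' ht fun n => (hu' n).1.le, (hu' 0).2⟩

lemma Gfun_eq_lintegral_qMeasure (η : ℝ → ℝ) (μ : Measure ℝ) (y a : ℝ) :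
    Gfun η μ y a = ∫⁻ x, qMeasure η y (uIoc y (y + a * x)) ∂μ := by
  simp only [Gfun, qfun_eq_qMeasure]

lemma measurable_qMeasure_uIoc_add_mul (η : ℝ → ℝ) (y a : ℝ) :
    Measurable fun x => qMeasure η y (uIoc y (y + a * x)) :=
  (measurable_measure_uIoc (qMeasure η y) y).comp (by fun_prop : Measurable fun x => y + a * x)

lemma Gfun_zero (η : ℝ → ℝ) (μ : Measure ℝ) (y : ℝ) : Gfun η μ y 0 = 0 := by
  simp [Gfun_eq_lintegral_qMeasure]

lemma Gfun_le_Gfun (η : ℝ → ℝ) (μ : Measure ℝ) (y : ℝ) {a b : ℝ} (ha : 0 ≤ a) (hab : a ≤ b) :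
    Gfun η μ y a ≤ Gfun η μ y b := by
  simp only [Gfun_eq_lintegral_qMeasure]
  exact lintegral_mono fun x => measure_mono (uIoc_add_mul_subset ha hab y x)

lemma Gfun_lt_Gfun {η : ℝ → ℝ} (hη : Measurable η) {μ : Measure ℝ} (hμ : μ {0}ᶜ ≠ 0) {y a b : ℝ}
    (ha : 0 ≤ a) (hab : a < b) (hfin : Gfun η μ y a ≠ ⊤) : Gfun η μ y a < Gfun η μ y b := by
  simp only [Gfun_eq_lintegral_qMeasure] at hfin ⊢
  refine lintegral_strict_mono_of_ae_le_of_ae_lt_on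
    (measurable_qMeasure_uIoc_add_mul η y b).aemeasurable hfin
    (ae_of_all _ fun x => measure_mono (uIoc_add_mul_subset ha hab.le y x)) hμ ?_
  filter_upwards [ae_lt_top (measurable_qMeasure_uIoc_add_mul η y a) hfin] with x hx hx0
  have hne : y + a * x ≠ y + b * x := fun h =>
    hab.ne (mul_right_cancel₀ hx0 (add_left_cancel h))
  have hdiff := qMeasure_ne_zero_of_uIoo_subset hη (y := y) hne
    (uIoo_add_mul_subset_diff ha hab y)
  rw [← measure_sdiff_add_inter (μ := qMeasure η y) (uIoc y (y + b * x))
    (measurableSet_uIoc (a := y) (b := y + a * x)),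
    inter_eq_self_of_subset_right (uIoc_add_mul_subset ha hab.le y x)]
  exact (ENNReal.lt_add_right hx.ne hdiff).trans_eq (add_comm _ _)

lemma Gfun_continuousWithinAt_Iic (η : ℝ → ℝ) (μ : Measure ℝ) (y : ℝ) {a : ℝ} (ha : 0 < a) :
    ContinuousWithinAt (fun b => Gfun η μ y b) (Iic a) a := by
  obtain ⟨b, hmono, hmem, hb⟩ := exists_seq_strictMono_tendsto' ha
  have hG : Gfun η μ y a = ⨆ n, Gfun η μ y (b n) := by
    simp only [Gfun_eq_lintegral_qMeasure]
    rw [← lintegral_iSup (fun n => measurable_qMeasure_uIoc_add_mul η y (b n))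
      fun m n h x => measure_mono
        (uIoc_add_mul_subset (hmem m).1.le (hmono.monotone h) y x)]
    exact lintegral_congr fun x => measure_uIoc_add_mul_eq_iSup _ hmono.monotone
      (fun n => (hmem n).1.le) (fun n => (hmem n).2) hb y x
  refine tendsto_order.mpr ⟨fun c hc => ?_, fun c hc => ?_⟩
  · obtain ⟨n, hn⟩ := lt_iSup_iff.mp (hc.trans_eq hG)
    filter_upwards [mem_nhdsWithin_of_mem_nhds (lt_mem_nhds (hmem n).2)] with d hd
    exact hn.trans_le (Gfun_le_Gfun η μ y (hmem n).1.le hd.le)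
  · filter_upwards [mem_nhdsWithin_of_mem_nhds (lt_mem_nhds ha), self_mem_nhdsWithin] with d hd hda
    exact (Gfun_le_Gfun η μ y hd.le hda).trans_lt hc

lemma Gfun_continuousWithinAt_Ici (η : ℝ → ℝ) (μ : Measure ℝ) (y : ℝ) {a c : ℝ} (ha : 0 ≤ a)
    (hac : a < c) (hc : Gfun η μ y c ≠ ⊤) :
    ContinuousWithinAt (fun b => Gfun η μ y b) (Ici a) a := by
  obtain ⟨b, hanti, hmem, hb⟩ := exists_seq_strictAnti_tendsto' hac
  have hfin : Gfun η μ y (b 0) ≠ ⊤ :=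
    ne_top_of_le_ne_top hc (Gfun_le_Gfun η μ y (ha.trans (hmem 0).1.le) (hmem 0).2.le)
  have hG : Gfun η μ y a = ⨅ n, Gfun η μ y (b n) := by
    simp only [Gfun_eq_lintegral_qMeasure] at hfin ⊢
    rw [← lintegral_iInf (fun n => measurable_qMeasure_uIoc_add_mul η y (b n))
      (fun m n h x => measure_mono
        (uIoc_add_mul_subset (ha.trans (hmem n).1.le) (hanti.antitone h) y x)) hfin]
    refine lintegral_congr_ae ?_
    filter_upwards [ae_lt_top (measurable_qMeasure_uIoc_add_mul η y (b 0)) hfin] with x hx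
    exact measure_uIoc_add_mul_eq_iInf _ hanti.antitone ha (fun n => (hmem n).1) hb hx.ne
  refine tendsto_order.mpr ⟨fun d hd => ?_, fun d hd => ?_⟩
  · filter_upwards [self_mem_nhdsWithin] with e he
    exact hd.trans_le (Gfun_le_Gfun η μ y ha he)
  · obtain ⟨n, hn⟩ := iInf_lt_iff.mp (hG.symm.trans_lt hd)
    filter_upwards [mem_nhdsWithin_of_mem_nhds (gt_mem_nhds (hmem n).1), self_mem_nhdsWithin]
      with e he hae
    exact (Gfun_le_Gfun η μ y (ha.trans hae) he.le).trans_lt hn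

lemma measure_compl_singleton_ne_zero {μ : Measure ℝ} [IsProbabilityMeasure μ] {c : ℝ}
    (hμ : μ ≠ Measure.dirac c) : μ {c}ᶜ ≠ 0 := by
  intro h
  refine hμ (Measure.ext fun s hs => ?_)
  by_cases hc : c ∈ s
  · rw [Measure.dirac_apply_of_mem hc, prob_compl_eq_zero_iff hs |>.mp]
    exact measure_mono_null (fun x hx (hxc : x = c) => hx (hxc ▸ hc)) h
  · rw [Measure.dirac_apply' c hs, indicator_of_notMem hc]
    exact measure_mono_null (fun x hx (hxc : x = c) => hc (hxc ▸ hx)) h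

/-- **Regularity of `G_y`**: for every `y ∈ I`, `G_y(0) = 0`; `G_y` is strictly increasing
(in the sense that for `0 ≤ a < b` either `G_y(a) < G_y(b)` or `G_y(a) = G_y(b) = ∞`);
`G_y` is left-continuous on `(0,∞)`; and `G_y` is continuous at every point of
`[0,∞) ∖ {a_inf}`, where `a_inf = inf {a ≥ 0 : G_y(a) = ∞}` (with `inf ∅ = ∞`, so that if
the set is empty there is no exceptional point).
Here `I` is an open subinterval of `ℝ` (an open order-connected set). -/
theorem Gfun_regularity
    (I : Set ℝ) (hIopen : IsOpen I) (hIconn : I.OrdConnected)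
    (η : ℝ → ℝ) (hηmeas : Measurable η)
    (hηne : ∀ x ∈ I, η x ≠ 0) (hηzero : ∀ x ∉ I, η x = 0)
    (hηloc : LocallyIntegrableOn (fun z => 1 / (η z) ^ 2) I volume)
    (μ : Measure ℝ) [IsProbabilityMeasure μ]
    (hμint : Integrable (fun x => x) μ) (hμcen : ∫ x, x ∂μ = 0)
    (hμne : μ ≠ Measure.dirac 0) :
    ∀ y ∈ I,
      Gfun η μ y 0 = 0 ∧
      (∀ a b : ℝ, 0 ≤ a → a < b →
        (Gfun η μ y a < Gfun η μ y b ∨ (Gfun η μ y a = ⊤ ∧ Gfun η μ y b = ⊤))) ∧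
      (∀ a : ℝ, 0 < a → ContinuousWithinAt (fun b => Gfun η μ y b) (Set.Iic a) a) ∧
      (∀ a : ℝ, 0 ≤ a →
        ({b : ℝ | 0 ≤ b ∧ Gfun η μ y b = ⊤} = ∅ ∨
          a ≠ sInf {b : ℝ | 0 ≤ b ∧ Gfun η μ y b = ⊤}) →
        ContinuousWithinAt (fun b => Gfun η μ y b) (Set.Ici 0) a) := by
  intro y _
  refine ⟨Gfun_zero η μ y, fun a b ha hab => ?_,
    fun a ha => Gfun_continuousWithinAt_Iic η μ y ha, fun a ha hinf => ?_⟩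
  · by_cases h : Gfun η μ y a = ⊤
    · exact Or.inr ⟨h, top_le_iff.mp (h ▸ Gfun_le_Gfun η μ y ha hab.le)⟩
    · exact Or.inl (Gfun_lt_Gfun hηmeas (measure_compl_singleton_ne_zero hμne) ha hab h)
  · by_cases hfin : ∃ c, a < c ∧ Gfun η μ y c ≠ ⊤
    · obtain ⟨c, hac, hc⟩ := hfin
      have hright := Gfun_continuousWithinAt_Ici η μ y ha hac hc
      rcases ha.eq_or_lt with rfl | ha'
      · exact hright
      · exact (continuousAt_iff_continuous_left_right.mpr
          ⟨Gfun_continuousWithinAt_Iic η μ y ha', hright⟩).continuousWithinAt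
    · push Not at hfin
      have hbdd : BddBelow {b : ℝ | 0 ≤ b ∧ Gfun η μ y b = ⊤} := ⟨0, fun b hb => hb.1⟩
      have hmem : ∀ c, a < c → c ∈ {b : ℝ | 0 ≤ b ∧ Gfun η μ y b = ⊤} := fun c hc =>
        ⟨ha.trans hc.le, hfin c hc⟩
      have hne : a ≠ sInf {b : ℝ | 0 ≤ b ∧ Gfun η μ y b = ⊤} :=
        hinf.resolve_left (nonempty_of_mem (hmem (a + 1) (lt_add_one a))).ne_empty
      have hlt : sInf {b : ℝ | 0 ≤ b ∧ Gfun η μ y b = ⊤} < a :=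
        lt_of_le_of_ne (le_of_forall_gt_imp_ge_of_dense fun c hc => csInf_le hbdd (hmem c hc))
          hne.symm
      obtain ⟨c, ⟨hc0, hc⟩, hca⟩ := exists_lt_of_csInf_lt
        (nonempty_of_mem (hmem (a + 1) (lt_add_one a))) hlt
      have htop : ∀ d, c ≤ d → Gfun η μ y d = ⊤ := fun d hd =>
        top_le_iff.mp (hc ▸ Gfun_le_Gfun η μ y hc0 hd)
      have hev : (fun b => Gfun η μ y b) =ᶠ[𝓝 a] fun _ => ⊤ := by
        filter_upwards [lt_mem_nhds hca] with d hd using htop d hd.le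
      exact (continuousAt_const.congr hev.symm).continuousWithinAt
end

section
/- Bound on the scale factor for bounded diffusion coefficient: Suppose there is U ∈ (0,∞) with |η(x)| ≤ U for all x ∈ I, and suppose there exist m ∈ I and a > 0 with G_m(a) < ∞. Then σ² := ∫ x² μ(dx) ∈ (0,∞), and for every N ∈ ℕ and every y ∈ I, the quantity a_N(y) := sup{a' ∈ [0,∞) : G_y(a') ≤ 1/N} satisfies a_N(y) ≤ U/√(N σ²) = A/√N with A := U/√(σ²). -/
open MeasureTheory Filter Set Topology
open scoped ENNReal

/-- If `|η| ≤ U` everywhere, then `2/U²` bounds the integrand `2/η²` from below. -/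
theorem two_div_ofReal_sq_le_qIntegrand {η : ℝ → ℝ} {U : ℝ} (hη : ∀ z, |η z| ≤ U) (z : ℝ) :
    2 / ENNReal.ofReal (U ^ 2) ≤ qIntegrand η z := by
  unfold qIntegrand
  gcongr 2 / ENNReal.ofReal ?_
  exact sq_le_sq' (abs_le.1 (hη z)).1 (abs_le.1 (hη z)).2

theorem lintegral_Ioc_ofReal_sub_left {y x : ℝ} (h : y ≤ x) :
    ∫⁻ u in Ioc y x, ENNReal.ofReal (u - y) = ENNReal.ofReal ((x - y) ^ 2 / 2) := by
  rw [← ofReal_integral_eq_lintegral_ofReal, ← intervalIntegral.integral_of_le h]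
  · congr 1
    rw [intervalIntegral.integral_comp_sub_right (fun t => t) y, integral_id]
    ring
  · exact (by fun_prop : Continuous fun u : ℝ => u - y).integrableOn_Ioc
  · filter_upwards [ae_restrict_mem measurableSet_Ioc] with u hu
    exact sub_nonneg.2 hu.1.le

theorem lintegral_Ioc_ofReal_sub_right {y x : ℝ} (h : x ≤ y) :
    ∫⁻ u in Ioc x y, ENNReal.ofReal (y - u) = ENNReal.ofReal ((x - y) ^ 2 / 2) := by
  rw [← ofReal_integral_eq_lintegral_ofReal, ← intervalIntegral.integral_of_le h]
  · congr 1
    rw [intervalIntegral.integral_comp_sub_left (fun t => t) y, integral_id]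
    ring
  · exact (by fun_prop : Continuous fun u : ℝ => y - u).integrableOn_Ioc
  · filter_upwards [ae_restrict_mem measurableSet_Ioc] with u hu
    exact sub_nonneg.2 hu.2

/-- If `|η| ≤ U` everywhere, then `q(y,x) ≥ (x - y)²/U²`. -/
theorem ofReal_sq_div_le_qfun {η : ℝ → ℝ} {U : ℝ} (hU : 0 < U) (hη : ∀ z, |η z| ≤ U) (y x : ℝ) :
    ENNReal.ofReal ((x - y) ^ 2 / U ^ 2) ≤ qfun η y x := by
  set c : ℝ≥0∞ := 2 / ENNReal.ofReal (U ^ 2) with hc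
  have hc' : ENNReal.ofReal ((x - y) ^ 2 / U ^ 2) = c * ENNReal.ofReal ((x - y) ^ 2 / 2) := by
    rw [hc, ← ENNReal.ofReal_ofNat 2, ← ENNReal.ofReal_div_of_pos (by positivity),
      ← ENNReal.ofReal_mul (by positivity)]
    congr 1
    field_simp
  have inner (s t : ℝ) :
      c * ENNReal.ofReal (t - s) ≤ ∫⁻ z in Ioc s t, qIntegrand η z :=
    calc c * ENNReal.ofReal (t - s) = ∫⁻ _ in Ioc s t, c := by
          rw [setLIntegral_const, Real.volume_Ioc]
      _ ≤ _ := lintegral_mono fun z => two_div_ofReal_sq_le_qIntegrand hη z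
  rw [hc']
  unfold qfun
  split_ifs with h
  · rw [← lintegral_Ioc_ofReal_sub_left h, ← lintegral_const_mul _ (by fun_prop)]
    exact lintegral_mono fun u => inner y u
  · rw [← lintegral_Ioc_ofReal_sub_right (not_le.1 h).le, ← lintegral_const_mul _ (by fun_prop)]
    exact lintegral_mono fun u => inner u y

/-- If `|η| ≤ U` everywhere, then `G_y(a) ≥ (a²/U²) ∫ x² μ(dx)`. -/
theorem mul_lintegral_sq_le_Gfun {η : ℝ → ℝ} {U : ℝ} (hU : 0 < U) (hη : ∀ z, |η z| ≤ U)
    (μ : Measure ℝ) (y a : ℝ) :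
    ENNReal.ofReal (a ^ 2 / U ^ 2) * ∫⁻ x, ENNReal.ofReal (x ^ 2) ∂μ ≤ Gfun η μ y a := by
  rw [← lintegral_const_mul _ (by fun_prop)]
  refine lintegral_mono fun x => ?_
  refine le_trans (le_of_eq ?_) (ofReal_sq_div_le_qfun hU hη y (y + a * x))
  rw [← ENNReal.ofReal_mul (by positivity)]
  congr 1
  ring

/-- A probability measure on `ℝ` with vanishing second moment is the Dirac mass at `0`. -/
theorem eq_dirac_zero_of_integral_sq_eq_zero {μ : Measure ℝ} [IsProbabilityMeasure μ]
    (hint : Integrable (fun x => x ^ 2) μ) (h : ∫ x, x ^ 2 ∂μ = 0) : μ = Measure.dirac 0 := by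
  have h0 : (fun x : ℝ => x) =ᵐ[μ] fun _ => 0 := by
    filter_upwards [(integral_eq_zero_iff_of_nonneg (fun x => sq_nonneg x) hint).1 h] with x hx
    exact pow_eq_zero_iff two_ne_zero |>.1 hx
  simpa [Measure.map_const] using Measure.map_congr h0

/-- **Bound on the scale factor for a bounded diffusion coefficient**: if `|η| ≤ U` on `I`
for some `U ∈ (0,∞)` and `G_m(a) < ∞` for some `m ∈ I`, `a > 0`, then
`σ² = ∫ x² μ(dx) ∈ (0,∞)` and for every `N ≥ 1` and `y ∈ I` the quantity
`a_N(y) = sup {a' ≥ 0 : G_y(a') ≤ 1/N}` satisfies `a_N(y) ≤ U/√(Nσ²) = A/√N` with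
`A = U/√σ²`.  Here `I` is an open subinterval of `ℝ` (an open order-connected set). -/
theorem scale_factor_bound_of_bounded_eta
    (I : Set ℝ) (hIopen : IsOpen I) (hIconn : I.OrdConnected)
    (η : ℝ → ℝ) (hηmeas : Measurable η)
    (hηne : ∀ x ∈ I, η x ≠ 0) (hηzero : ∀ x ∉ I, η x = 0)
    (hηloc : LocallyIntegrableOn (fun z => 1 / (η z) ^ 2) I volume)
    (μ : Measure ℝ) [IsProbabilityMeasure μ]
    (hμint : Integrable (fun x => x) μ) (hμcen : ∫ x, x ∂μ = 0)
    (hμne : μ ≠ Measure.dirac 0)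
    (U : ℝ) (hU : 0 < U) (hηU : ∀ x ∈ I, |η x| ≤ U)
    (m : ℝ) (hm : m ∈ I) (a : ℝ) (ha : 0 < a) (hGm : Gfun η μ m a < ⊤) :
    Integrable (fun x => x ^ 2) μ ∧ 0 < ∫ x, x ^ 2 ∂μ ∧
    (∀ N : ℕ, 1 ≤ N → ∀ y ∈ I,
      sSup {a' : ℝ | 0 ≤ a' ∧ Gfun η μ y a' ≤ 1 / (N : ℝ≥0∞)}
        ≤ U / Real.sqrt ((N : ℝ) * ∫ x, x ^ 2 ∂μ)) ∧
    (∀ N : ℕ, 1 ≤ N →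
      U / Real.sqrt ((N : ℝ) * ∫ x, x ^ 2 ∂μ)
        = (U / Real.sqrt (∫ x, x ^ 2 ∂μ)) / Real.sqrt (N : ℝ)) := by
  have hη : ∀ z, |η z| ≤ U := fun z => by
    by_cases hz : z ∈ I
    · exact hηU z hz
    · simpa [hηzero z hz] using hU.le
  have hfin : ∫⁻ x, ENNReal.ofReal (x ^ 2) ∂μ < ⊤ := by
    by_contra htop
    have hle := mul_lintegral_sq_le_Gfun hU hη μ m a
    rw [not_lt_top_iff.1 htop,
      ENNReal.mul_top (ENNReal.ofReal_pos.2 (by positivity)).ne'] at hle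
    exact absurd hGm (not_lt.2 hle)
  have hint : Integrable (fun x => x ^ 2) μ :=
    ⟨by fun_prop, (hasFiniteIntegral_iff_ofReal (ae_of_all _ fun x => sq_nonneg x)).2 hfin⟩
  have hpos : 0 < ∫ x, x ^ 2 ∂μ :=
    (integral_nonneg fun x => sq_nonneg x).lt_of_ne' fun h =>
      hμne (eq_dirac_zero_of_integral_sq_eq_zero hint h)
  have hlint : ∫⁻ x, ENNReal.ofReal (x ^ 2) ∂μ = ENNReal.ofReal (∫ x, x ^ 2 ∂μ) :=
    (ofReal_integral_eq_lintegral_ofReal hint (ae_of_all _ fun x => sq_nonneg x)).symm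
  set v := ∫ x, x ^ 2 ∂μ
  refine ⟨hint, hpos, fun N hN y _ => Real.sSup_le ?_ (by positivity), fun N _ => ?_⟩
  · rintro b ⟨hb, hG⟩
    have hN' : (0 : ℝ) < N := by exact_mod_cast hN
    have hle := (mul_lintegral_sq_le_Gfun hU hη μ y b).trans hG
    rw [hlint, ← ENNReal.ofReal_mul (by positivity), ← ENNReal.ofReal_natCast N,
      ← ENNReal.ofReal_one, ← ENNReal.ofReal_div_of_pos hN',
      ENNReal.ofReal_le_ofReal_iff (by positivity), div_mul_eq_mul_div,
      div_le_div_iff₀ (by positivity) hN'] at hle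
    rw [le_div_iff₀ (by positivity)]
    refine le_of_sq_le_sq ?_ hU.le
    rw [mul_pow, Real.sq_sqrt (by positivity)]
    linarith
  · rw [mul_comm, Real.sqrt_mul hpos.le, div_div]
end
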